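/- Let (X_{i,j}) be an orthomartingale difference random field in the commuting filtration setting, assume |X_{0,0}| ≤ C almost surely, S is ergodic, and E(X_{0,0}^2) = σ^2. For integers k ≥ 0 and v ≥ 1 set F_{k,v} = v^{-1/2} Σ_{j=0}^{v-1} X_{k,j}, and let E_{∞,0} denote conditional expectation with respect to F_{∞,0} = σ(∪_{n∈Z} F_{n,0}). Then almost surely, lim_{m→∞} limsup_{v→∞} E_{∞,0} | m^{-1} Σ_{k=0}^{m-1} F_{k,v}^2 − σ^2 | = 0. -/

import Mathlib

open MeasureTheory ProbabilityTheory Filter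
open scoped ENNReal NNReal Topology

/-- A real function that is bounded and measurable with respect to `m`. -/
def BddMeas {Ω : Type*} (m : MeasurableSpace Ω) (f : Ω → ℝ) : Prop :=
  Measurable[m] f ∧ ∃ B, ∀ x, |f x| ≤ B

namespace BddMeas

variable {Ω : Type*} {m : MeasurableSpace Ω} {f g : Ω → ℝ}

theorem const (c : ℝ) : BddMeas m (fun _ => c) := ⟨measurable_const, |c|, fun _ => le_rfl⟩

theorem add (hf : BddMeas m f) (hg : BddMeas m g) : BddMeas m (fun x => f x + g x) := by
  obtain ⟨hf, A, hA⟩ := hf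
  obtain ⟨hg, B, hB⟩ := hg
  exact ⟨hf.add hg, A + B, fun x => (abs_add_le _ _).trans (add_le_add (hA x) (hB x))⟩

theorem mul (hf : BddMeas m f) (hg : BddMeas m g) : BddMeas m (fun x => f x * g x) := by
  obtain ⟨hf, A, hA⟩ := hf
  obtain ⟨hg, B, hB⟩ := hg
  refine ⟨hf.mul hg, A * B, fun x => ?_⟩
  rw [abs_mul]
  exact mul_le_mul (hA x) (hB x) (abs_nonneg _) ((abs_nonneg _).trans (hA x))

theorem sub (hf : BddMeas m f) (hg : BddMeas m g) : BddMeas m (fun x => f x - g x) := by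
  simpa [sub_eq_add_neg] using hf.add ((const (-1)).mul hg)

theorem div_const (hf : BddMeas m f) (c : ℝ) : BddMeas m (fun x => f x / c) := by
  simpa only [div_eq_mul_inv] using hf.mul (const c⁻¹)

theorem pow (hf : BddMeas m f) (n : ℕ) : BddMeas m (fun x => f x ^ n) := by
  induction n with
  | zero => simpa using const 1
  | succ n ih => simpa only [pow_succ] using ih.mul hf

theorem abs (hf : BddMeas m f) : BddMeas m (fun x => |f x|) := by
  obtain ⟨hf, A, hA⟩ := hf
  exact ⟨_root_.measurable_abs.comp hf, A, fun x => by simpa using hA x⟩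

theorem sum {ι : Type*} (s : Finset ι) {f : ι → Ω → ℝ} (hf : ∀ i ∈ s, BddMeas m (f i)) :
    BddMeas m (fun x => ∑ i ∈ s, f i x) := by
  classical
  induction s using Finset.induction_on with
  | empty => simpa using const 0
  | insert a s ha ih =>
    simp only [Finset.sum_insert ha]
    exact (hf a (by simp)).add (ih fun i hi => hf i (by simp [hi]))

theorem mono {m' : MeasurableSpace Ω} (hf : BddMeas m f) (h : m ≤ m') : BddMeas m' f :=
  ⟨hf.1.mono h le_rfl, hf.2⟩

theorem comp {Ω' : Type*} {m' : MeasurableSpace Ω'} (hf : BddMeas m f) {τ : Ω' → Ω}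
    (hτ : Measurable τ) : BddMeas m' (fun x => f (τ x)) :=
  ⟨hf.1.comp hτ, hf.2.imp fun _ hB _ => hB _⟩

theorem integrable (hf : BddMeas m f) (μ : Measure Ω) [IsFiniteMeasure μ] : Integrable f μ := by
  obtain ⟨hf, A, hA⟩ := hf
  exact Integrable.of_bound hf.aestronglyMeasurable A (ae_of_all _ hA)

end BddMeas

theorem MeasureTheory.MeasurePreserving.integral_comp_bddMeas {Ω : Type*} {m : MeasurableSpace Ω}
    {P : Measure Ω} {τ : Ω → Ω} (hτ : MeasurePreserving τ P P) {f : Ω → ℝ} (hf : BddMeas m f) :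
    ∫ x, f (τ x) ∂P = ∫ x, f x ∂P := by
  conv_rhs => rw [← hτ.map_eq]
  exact (integral_map hτ.aemeasurable hf.1.aestronglyMeasurable).symm

section Birkhoff

variable {Ω : Type*} {τ : Ω → Ω}

/-- The running maximum `max(0, f, f + f ∘ τ, …)` of the Birkhoff sums of `f`. -/
def birkhoffMax (τ : Ω → Ω) (f : Ω → ℝ) : ℕ → Ω → ℝ
  | 0, _ => 0
  | n + 1, x => max 0 (f x + birkhoffMax τ f n (τ x))

theorem birkhoffMax_le_succ (f : Ω → ℝ) (n : ℕ) (x : Ω) :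
    birkhoffMax τ f n x ≤ birkhoffMax τ f (n + 1) x := by
  induction n generalizing x with
  | zero => exact le_max_left _ _
  | succ n ih => exact max_le_max le_rfl (add_le_add le_rfl (ih _))

theorem sum_le_birkhoffMax (f : Ω → ℝ) (n : ℕ) (x : Ω) :
    ∑ i ∈ Finset.range n, f (τ^[i] x) ≤ birkhoffMax τ f n x := by
  induction n generalizing x with
  | zero => simp [birkhoffMax]
  | succ n ih =>
    rw [Finset.sum_range_succ']
    have := ih (τ x)
    simp only [Function.iterate_succ_apply, Function.iterate_zero, id]
    exact le_max_of_le_right (by linarith)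

variable [MeasurableSpace Ω] {P : Measure Ω} [IsProbabilityMeasure P]

theorem bddMeas_birkhoffMax (hτ : Measurable τ) {f : Ω → ℝ} (hf : BddMeas ‹_› f) (n : ℕ) :
    BddMeas ‹_› (birkhoffMax τ f n) := by
  induction n with
  | zero => exact BddMeas.const 0
  | succ n ih =>
    have h : BddMeas _ (fun x => f x + birkhoffMax τ f n (τ x)) :=
      hf.add (ih.comp hτ)
    obtain ⟨h1, B, hB⟩ := h
    refine ⟨measurable_const.max h1, B, fun x => ?_⟩
    have := hB x
    rw [birkhoffMax]
    exact abs_max_le_max_abs_abs.trans (max_le (by simpa using (abs_nonneg _).trans this) this)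

/-- The Birkhoff sums of a function with negative integral are a.e. bounded above. -/
theorem Ergodic.ae_exists_birkhoffMax_le (hτ : Ergodic τ P) {f : Ω → ℝ} (hf : BddMeas ‹_› f)
    (hneg : ∫ x, f x ∂P < 0) : ∀ᵐ x ∂P, ∃ k : ℕ, ∀ n, birkhoffMax τ f n x ≤ k := by
  have hm := bddMeas_birkhoffMax hτ.measurable hf
  set E : Set Ω := {x | ∃ k : ℕ, ∀ n, birkhoffMax τ f n x ≤ k} with hE
  have hEm : MeasurableSet E := by
    have : E = ⋃ k : ℕ, ⋂ n, {x | birkhoffMax τ f n x ≤ k} := by ext; simp [hE]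
    rw [this]
    exact .iUnion fun k => .iInter fun n => measurableSet_le (hm n).1 measurable_const
  have hinv : τ ⁻¹' E = E := by
    ext x
    constructor
    · rintro ⟨k, hk⟩
      obtain ⟨l, hl⟩ := exists_nat_ge (f x + k)
      refine ⟨l, fun n => (birkhoffMax_le_succ f n x).trans (max_le (by positivity) ?_)⟩
      exact (add_le_add le_rfl (hk n)).trans hl
    · rintro ⟨k, hk⟩
      obtain ⟨l, hl⟩ := exists_nat_ge (k - f x)
      refine ⟨l, fun n => ?_⟩
      have := (le_max_right _ _).trans (hk (n + 1))
      linarith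
  refine (hτ.toPreErgodic.ae_mem_or_ae_notMem hEm hinv).resolve_right fun hnot => ?_
  have hlim : Tendsto (fun n => ∫ x, (birkhoffMax τ f (n + 1) x - birkhoffMax τ f n (τ x)) ∂P)
      atTop (𝓝 (∫ x, f x ∂P)) := by
    obtain ⟨B, hB⟩ := hf.2
    refine tendsto_integral_of_dominated_convergence (fun _ => B)
      (fun n => ((hm (n + 1)).1.sub ((hm n).1.comp hτ.measurable)).aestronglyMeasurable)
      (integrable_const _) (fun n => ae_of_all _ fun x => ?_) ?_
    · have h0 : 0 ≤ birkhoffMax τ f n (τ x) := by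
        cases n with
        | zero => exact le_rfl
        | succ n => exact le_max_left _ _
      have := abs_le.1 (hB x)
      rw [birkhoffMax, Real.norm_eq_abs, abs_le]
      rcases max_cases 0 (f x + birkhoffMax τ f n (τ x)) with h | h <;> constructor <;> linarith
    · filter_upwards [hnot] with x hx
      have hx' : τ x ∉ E := fun h => hx (hinv ▸ h)
      refine tendsto_const_nhds.congr' ?_
      obtain ⟨k, hk⟩ := exists_nat_ge (-f x)
      simp only [hE, Set.mem_ofPred_eq, not_exists, not_forall, not_le] at hx'
      obtain ⟨N, hN⟩ := hx' k
      filter_upwards [eventually_ge_atTop N] with n hn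
      have h1 : birkhoffMax τ f N (τ x) ≤ birkhoffMax τ f n (τ x) :=
        monotone_nat_of_le_succ (f := fun n => birkhoffMax τ f n (τ x))
          (fun n => birkhoffMax_le_succ f n _) hn
      rw [birkhoffMax, max_eq_right (by linarith)]
      ring
  refine hneg.not_ge (ge_of_tendsto' hlim fun n => ?_)
  rw [integral_sub ((hm _).integrable P) (((hm n).comp hτ.measurable).integrable P),
    hτ.toMeasurePreserving.integral_comp_bddMeas (hm n)]
  exact sub_nonneg.2 (integral_mono ((hm _).integrable P) ((hm _).integrable P)
    (birkhoffMax_le_succ f n))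

theorem Ergodic.ae_eventually_birkhoff_le (hτ : Ergodic τ P) {f : Ω → ℝ} (hf : BddMeas ‹_› f) :
    ∀ᵐ x ∂P, ∀ ε : ℝ, 0 < ε →
      ∀ᶠ n : ℕ in atTop, (∑ i ∈ Finset.range n, f (τ^[i] x)) / n ≤ ∫ y, f y ∂P + ε := by
  have key : ∀ k : ℕ, ∀ᵐ x ∂P, ∃ l : ℕ, ∀ n,
      birkhoffMax τ (fun x => f x - (∫ y, f y ∂P + 1 / ((k : ℝ) + 1))) n x ≤ l := fun k => by
    refine hτ.ae_exists_birkhoffMax_le (hf.sub (.const _)) ?_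
    rw [integral_sub (hf.integrable P) (integrable_const _)]
    simp only [integral_const, probReal_univ, smul_eq_mul, one_mul]
    have : (0 : ℝ) < 1 / ((k : ℝ) + 1) := by positivity
    linarith
  filter_upwards [ae_all_iff.2 key] with x hx ε hε
  obtain ⟨k, hk⟩ := exists_nat_one_div_lt (half_pos hε)
  obtain ⟨l, hl⟩ := hx k
  obtain ⟨N, hN⟩ := exists_nat_ge (l / (ε / 2))
  filter_upwards [eventually_ge_atTop N, eventually_gt_atTop 0] with n hn hn0
  have h1 := (sum_le_birkhoffMax _ n x).trans (hl n)
  rw [Finset.sum_sub_distrib] at h1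
  simp only [Finset.sum_const, Finset.card_range, nsmul_eq_mul] at h1
  have hn0' : (0 : ℝ) < n := by exact_mod_cast hn0
  have h2 : (l : ℝ) ≤ n * (ε / 2) := by
    rw [div_le_iff₀ (by linarith)] at hN
    exact hN.trans (mul_le_mul_of_nonneg_right (by exact_mod_cast hn) (by linarith))
  rw [div_le_iff₀ hn0']
  nlinarith

/-- **Birkhoff's pointwise ergodic theorem** for bounded functions and an ergodic map. -/
theorem Ergodic.ae_tendsto_birkhoff (hτ : Ergodic τ P) {f : Ω → ℝ} (hf : BddMeas ‹_› f) :
    ∀ᵐ x ∂P, Tendsto (fun n : ℕ => (∑ i ∈ Finset.range n, f (τ^[i] x)) / n) atTop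
      (𝓝 (∫ y, f y ∂P)) := by
  filter_upwards [hτ.ae_eventually_birkhoff_le hf,
    hτ.ae_eventually_birkhoff_le (hf.mul (.const (-1)))] with x h1 h2
  rw [Metric.tendsto_nhds]
  intro ε hε
  filter_upwards [h1 _ (half_pos hε), h2 _ (half_pos hε)] with n a1 a2
  rw [integral_mul_const, ← Finset.sum_mul, mul_div_right_comm] at a2
  rw [Real.dist_eq, abs_lt]
  constructor <;> linarith

end Birkhoff

/-- Comparison of a weighted sum with its time shift, by summation by parts. -/
theorem abs_sum_mul_sub_sum_mul_shift_le {q A : ℕ → ℝ} {K : ℝ} (hq : ∀ j, |q j| ≤ K) (v i : ℕ) :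
    |∑ j ∈ Finset.range v, A j * q j - ∑ j ∈ Finset.range v, A j * q (j + i)| ≤
      i * (K * (|A 0| + |A v| + ∑ j ∈ Finset.range v, |A (j + 1) - A j|)) := by
  induction i with
  | zero => simp
  | succ i ih =>
    have h : ∑ j ∈ Finset.range v, A j * q (j + i) - ∑ j ∈ Finset.range v, A j * q (j + (i + 1)) =
        A 0 * q i - A v * q (v + i) +
          ∑ j ∈ Finset.range v, (A (j + 1) - A j) * q (j + (i + 1)) := by
      have h1 := Finset.sum_range_succ' (fun j => A j * q (j + i)) v
      rw [Finset.sum_range_succ] at h1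
      simp only [sub_mul, Finset.sum_sub_distrib]
      have h2 : ∑ j ∈ Finset.range v, A (j + 1) * q (j + (i + 1)) =
          ∑ j ∈ Finset.range v, A (j + 1) * q (j + 1 + i) :=
        Finset.sum_congr rfl fun j _ => by rw [add_assoc, add_comm 1 i]
      simp only [zero_add] at h1
      rw [h2]
      linarith
    have hmul : ∀ a j, |a * q j| ≤ K * |a| := fun a j => by
      rw [abs_mul, mul_comm]
      exact mul_le_mul_of_nonneg_right (hq j) (abs_nonneg a)
    have h3 : |∑ j ∈ Finset.range v, (A (j + 1) - A j) * q (j + (i + 1))| ≤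
        K * ∑ j ∈ Finset.range v, |A (j + 1) - A j| := by
      rw [Finset.mul_sum]
      exact (Finset.abs_sum_le_sum_abs _ _).trans (Finset.sum_le_sum fun j _ => hmul _ _)
    have h4 := hmul (A 0) i
    have h5 := hmul (A v) (v + i)
    rw [abs_le] at *
    push_cast
    constructor <;> nlinarith

/-- A weighted sum is controlled by the squares of the weights, the squares of the sliding window
averages, and the variation of the weights. -/
theorem abs_sum_mul_le_window {q A : ℕ → ℝ} {K : ℝ} (hq : ∀ j, |q j| ≤ K) (v : ℕ) {b : ℕ}
    (hb : 0 < b) {η : ℝ} (hη : 0 < η) :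
    |∑ j ∈ Finset.range v, A j * q j| ≤
      ∑ j ∈ Finset.range v, (η * A j ^ 2 + ((∑ i ∈ Finset.range b, q (j + i)) / b) ^ 2 / η) +
      b * (K * (2 + A 0 ^ 2 + A v ^ 2 + ∑ j ∈ Finset.range v, |A (j + 1) - A j|)) := by
  have hb' : (0 : ℝ) < b := by exact_mod_cast hb
  have hK : 0 ≤ K := (abs_nonneg _).trans (hq 0)
  have hsq : ∀ a : ℝ, |a| ≤ 1 + a ^ 2 := fun a => by
    rw [← sq_abs]; nlinarith [sq_nonneg (|a| - 1), abs_nonneg a]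
  set D := K * (2 + A 0 ^ 2 + A v ^ 2 + ∑ j ∈ Finset.range v, |A (j + 1) - A j|) with hD
  have hDle : K * (|A 0| + |A v| + ∑ j ∈ Finset.range v, |A (j + 1) - A j|) ≤ D := by
    refine mul_le_mul_of_nonneg_left ?_ hK
    linarith [hsq (A 0), hsq (A v)]
  have hD0 : 0 ≤ D := le_trans (by positivity) hDle
  have havg : ∑ j ∈ Finset.range v, A j * q j - ∑ j ∈ Finset.range v,
      A j * ((∑ i ∈ Finset.range b, q (j + i)) / b) =
      (∑ i ∈ Finset.range b, (∑ j ∈ Finset.range v, A j * q j -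
        ∑ j ∈ Finset.range v, A j * q (j + i))) / b := by
    rw [Finset.sum_sub_distrib]
    simp only [Finset.sum_const, Finset.card_range, nsmul_eq_mul, sub_div,
      ← mul_div_assoc, ← Finset.sum_div]
    rw [mul_div_cancel_left₀ _ hb'.ne']
    simp only [Finset.mul_sum]
    rw [Finset.sum_comm]
  have h1 : |∑ j ∈ Finset.range v, A j * q j - ∑ j ∈ Finset.range v,
      A j * ((∑ i ∈ Finset.range b, q (j + i)) / b)| ≤ b * D := by
    rw [havg, abs_div, abs_of_pos hb', div_le_iff₀ hb']
    refine (Finset.abs_sum_le_sum_abs _ _).trans ?_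
    refine (Finset.sum_le_card_nsmul _ _ (b * D) fun i hi => ?_).trans (by simp [mul_comm])
    refine (abs_sum_mul_sub_sum_mul_shift_le hq v i).trans
      (mul_le_mul ?_ hDle (by positivity) hb'.le)
    exact_mod_cast (Finset.mem_range.1 hi).le
  have h2 : |∑ j ∈ Finset.range v, A j * ((∑ i ∈ Finset.range b, q (j + i)) / b)| ≤
      ∑ j ∈ Finset.range v, (η * A j ^ 2 + ((∑ i ∈ Finset.range b, q (j + i)) / b) ^ 2 / η) := by
    refine (Finset.abs_sum_le_sum_abs _ _).trans (Finset.sum_le_sum fun j _ => ?_)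
    generalize (∑ i ∈ Finset.range b, q (j + i)) / (b : ℝ) = h
    have hh : h ^ 2 / η = η * (h / η) ^ 2 := by field_simp
    have hp : A j * h = η * (A j * (h / η)) := by field_simp
    rw [hh, hp, abs_mul, abs_of_pos hη, ← mul_add]
    refine mul_le_mul_of_nonneg_left (abs_le.2 ⟨?_, ?_⟩) hη.le <;>
      nlinarith [sq_nonneg (A j + h / η), sq_nonneg (A j - h / η), sq_nonneg (A j),
        sq_nonneg (h / η)]
  have h3 := abs_add_le (∑ j ∈ Finset.range v, A j * q j - ∑ j ∈ Finset.range v,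
      A j * ((∑ i ∈ Finset.range b, q (j + i)) / b)) (∑ j ∈ Finset.range v,
      A j * ((∑ i ∈ Finset.range b, q (j + i)) / b))
  rw [sub_add_cancel] at h3
  linarith

/-- The squares of the sliding window averages of `q` of length `b` have asymptotic mean `e b`,
where `e b → 0`. -/
def WindowMeanVanishes {Ω : Type*} {m : MeasurableSpace Ω} (μ : Measure Ω) (q : ℕ → Ω → ℝ) :
    Prop :=
  ∃ e : ℕ → ℝ, Tendsto e atTop (𝓝 0) ∧ ∀ b : ℕ, 0 < b →
    Tendsto (fun v : ℕ => (∑ j ∈ Finset.range v,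
      ∫ x, ((∑ i ∈ Finset.range b, q (j + i) x) / b) ^ 2 ∂μ) / v) atTop (𝓝 (e b))

/-- Averages of `q` with slowly varying weights vanish in mean. -/
theorem tendsto_integral_abs_weighted_sum {Ω : Type*} {m : MeasurableSpace Ω} (μ : Measure Ω)
    [IsProbabilityMeasure μ] {q : ℕ → Ω → ℝ} {K : ℝ} (hqm : ∀ j, BddMeas m (q j))
    (hqK : ∀ j x, |q j x| ≤ K) (hq : WindowMeanVanishes μ q)
    {A : ℕ → ℕ → Ω → ℝ} (hAm : ∀ v j, BddMeas m (A v j)) {L : ℝ}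
    (hA : ∀ v j, j ≤ v → ∫ x, A v j x ^ 2 ∂μ ≤ L) {a : ℕ → ℝ} (ha : Tendsto a atTop (𝓝 0))
    (hΔ : ∀ v j, j < v → ∫ x, |A v (j + 1) x - A v j x| ∂μ ≤ a v) :
    Tendsto (fun v : ℕ => (∫ x, |∑ j ∈ Finset.range v, A v j x * q j x| ∂μ) / v) atTop
      (𝓝 0) := by
  obtain ⟨e, he, hq⟩ := hq
  have hL : 0 ≤ L := (integral_nonneg fun x => sq_nonneg _).trans (hA 0 0 le_rfl)
  obtain ⟨x0⟩ : Nonempty Ω := nonempty_of_isProbabilityMeasure μ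
  have hK : 0 ≤ K := (abs_nonneg _).trans (hqK 0 x0)
  have hbound : ∀ η : ℝ, 0 < η → ∀ b : ℕ, 0 < b → ∀ v : ℕ, 0 < v →
      (∫ x, |∑ j ∈ Finset.range v, A v j x * q j x| ∂μ) / v ≤
        η * L + ((∑ j ∈ Finset.range v,
          ∫ x, ((∑ i ∈ Finset.range b, q (j + i) x) / b) ^ 2 ∂μ) / v) / η +
        b * K * ((2 + 2 * L) / v + a v) := by
    intro η hη b hb v hv
    have hv' : (0 : ℝ) < v := by exact_mod_cast hv
    have hwin : ∀ j, BddMeas m (fun x => ((∑ i ∈ Finset.range b, q (j + i) x) / b) ^ 2) :=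
      fun j => ((BddMeas.sum _ fun i _ => hqm (j + i)).div_const _).pow 2
    have hd : ∀ j, BddMeas m (fun x => |A v (j + 1) x - A v j x|) :=
      fun j => ((hAm _ _).sub (hAm _ _)).abs
    have hA2 : ∀ j, BddMeas m (fun x => A v j x ^ 2) := fun j => (hAm _ _).pow 2
    have hterm : ∀ j, BddMeas m (fun x => η * A v j x ^ 2 +
        ((∑ i ∈ Finset.range b, q (j + i) x) / b) ^ 2 / η) :=
      fun j => ((BddMeas.const η).mul (hA2 j)).add ((hwin j).div_const η)
    have hlast : BddMeas m (fun x => 2 + A v 0 x ^ 2 + A v v x ^ 2 +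
        ∑ j ∈ Finset.range v, |A v (j + 1) x - A v j x|) :=
      (((BddMeas.const 2).add (hA2 0)).add (hA2 v)).add (BddMeas.sum _ fun j _ => hd j)
    have h1 := integral_mono
      ((BddMeas.sum (Finset.range v) fun j _ => (hAm v j).mul (hqm j)).abs.integrable μ)
      (((BddMeas.sum (Finset.range v) fun j _ => hterm j).add
        ((BddMeas.const (b : ℝ)).mul ((BddMeas.const K).mul hlast))).integrable μ)
      (fun x => abs_sum_mul_le_window (fun j => hqK j x) (A := fun j => A v j x) v hb hη)
    rw [integral_add ((BddMeas.sum (Finset.range v) fun j _ => hterm j).integrable μ)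
        (((BddMeas.const (b : ℝ)).mul ((BddMeas.const K).mul hlast)).integrable μ),
      integral_finsetSum _ (fun j _ => (hterm j).integrable μ), integral_const_mul,
      integral_const_mul,
      integral_add ((((BddMeas.const 2).add (hA2 0)).add (hA2 v)).integrable μ)
        ((BddMeas.sum (Finset.range v) fun j _ => hd j).integrable μ),
      integral_add (((BddMeas.const 2).add (hA2 0)).integrable μ) ((hA2 v).integrable μ),
      integral_add ((BddMeas.const 2).integrable μ) ((hA2 0).integrable μ),
      integral_finsetSum _ (fun j _ => (hd j).integrable μ)] at h1
    simp only [integral_const, probReal_univ, smul_eq_mul, one_mul] at h1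
    have h2 : ∑ j ∈ Finset.range v, ∫ x, |A v (j + 1) x - A v j x| ∂μ ≤ v * a v := by
      refine (Finset.sum_le_card_nsmul _ _ (a v) fun j hj => hΔ v j (Finset.mem_range.1 hj)).trans
        (by simp)
    have h3 : ∑ j ∈ Finset.range v, ∫ x, (η * A v j x ^ 2 +
        ((∑ i ∈ Finset.range b, q (j + i) x) / b) ^ 2 / η) ∂μ ≤ v * (η * L) +
        (∑ j ∈ Finset.range v,
          ∫ x, ((∑ i ∈ Finset.range b, q (j + i) x) / b) ^ 2 ∂μ) / η := by
      have : ∀ j ∈ Finset.range v, ∫ x, (η * A v j x ^ 2 +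
        ((∑ i ∈ Finset.range b, q (j + i) x) / b) ^ 2 / η) ∂μ ≤ η * L +
          (∫ x, ((∑ i ∈ Finset.range b, q (j + i) x) / b) ^ 2 ∂μ) / η := fun j hj => by
        rw [integral_add (((BddMeas.const η).mul (hA2 j)).integrable μ)
          (((hwin j).div_const η).integrable μ), integral_const_mul, integral_div]
        have := mul_le_mul_of_nonneg_left (hA v j (Finset.mem_range.1 hj).le) hη.le
        linarith
      refine (Finset.sum_le_sum this).trans (le_of_eq ?_)
      rw [Finset.sum_add_distrib, Finset.sum_div]
      simp
    have h4 : b * (K * (2 + ∫ x, A v 0 x ^ 2 ∂μ + ∫ x, A v v x ^ 2 ∂μ +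
        ∑ j ∈ Finset.range v, ∫ x, |A v (j + 1) x - A v j x| ∂μ)) ≤
        b * (K * (2 + 2 * L + v * a v)) := by
      have := hA v 0 (Nat.zero_le _)
      have := hA v v le_rfl
      refine mul_le_mul_of_nonneg_left (mul_le_mul_of_nonneg_left ?_ hK) (Nat.cast_nonneg _)
      linarith
    rw [div_le_iff₀ hv']
    refine (h1.trans (add_le_add h3 h4)).trans (le_of_eq ?_)
    field_simp
  have hinv : Tendsto (fun v : ℕ => (2 + 2 * L) / (v : ℝ)) atTop (𝓝 0) :=
    tendsto_const_div_atTop_nhds_zero_nat _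
  rw [Metric.tendsto_nhds]
  intro ε hε
  set η := ε / (4 * (L + 1)) with hη
  have hη0 : 0 < η := by positivity
  have hηL : η * L ≤ ε / 4 := by
    rw [hη, div_mul_eq_mul_div, div_le_div_iff₀ (by positivity) (by positivity)]
    nlinarith
  obtain ⟨b, hb, hb0⟩ := ((he.eventually_lt_const (by positivity : 0 < η * (ε / 4))).and
    (eventually_gt_atTop 0)).exists
  have hlim : Tendsto (fun v : ℕ => b * K * ((2 + 2 * L) / v + a v)) atTop (𝓝 0) := by
    simpa using (hinv.add ha).const_mul (b * K)
  filter_upwards [(hq b hb0).eventually_lt_const hb,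
    hlim.eventually_lt_const (by positivity : 0 < ε / 4), eventually_gt_atTop 0] with v h1 h2 hv
  have h3 := hbound η hη0 b hb0 v hv
  have h4 := (div_lt_iff₀' hη0).2 h1
  rw [Real.dist_eq, sub_zero, abs_of_nonneg (div_nonneg (integral_nonneg fun x => abs_nonneg _)
    (Nat.cast_nonneg _))]
  linarith

section Moments

variable {Ω : Type*} {m : MeasurableSpace Ω} {μ : Measure Ω} [IsProbabilityMeasure μ]
  {C : ℝ}

theorem integral_sq_sum_le {y : ℕ → Ω → ℝ} (hy : ∀ j, BddMeas m (y j))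
    (hyC : ∀ j ω, |y j ω| ≤ C)
    (h1 : ∀ j, ∫ ω, (∑ i ∈ Finset.range j, y i ω) * y j ω ∂μ = 0) (j : ℕ) :
    ∫ ω, (∑ i ∈ Finset.range j, y i ω) ^ 2 ∂μ ≤ C ^ 2 * j := by
  induction j with
  | zero => simp
  | succ j ih =>
    have hs : BddMeas m (fun ω => ∑ i ∈ Finset.range j, y i ω) := BddMeas.sum _ fun i _ => hy i
    have h2 : ∫ ω, (∑ i ∈ Finset.range (j + 1), y i ω) ^ 2 ∂μ ≤
        ∫ ω, ((∑ i ∈ Finset.range j, y i ω) ^ 2 +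
          2 * ((∑ i ∈ Finset.range j, y i ω) * y j ω) + C ^ 2) ∂μ := by
      refine integral_mono
        (((BddMeas.sum (Finset.range (j + 1)) fun i _ => hy i).pow 2).integrable μ)
        ((((hs.pow 2).add ((BddMeas.const 2).mul (hs.mul (hy j)))).add
          (BddMeas.const _)).integrable μ) fun ω => ?_
      have := sq_le_sq' (abs_le.1 (hyC j ω)).1 (abs_le.1 (hyC j ω)).2
      simp only [Finset.sum_range_succ]
      nlinarith
    rw [integral_add (((hs.pow 2).add ((BddMeas.const 2).mul (hs.mul (hy j)))).integrable μ)
        ((BddMeas.const _).integrable μ), integral_add ((hs.pow 2).integrable μ)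
        (((BddMeas.const 2).mul (hs.mul (hy j))).integrable μ), integral_const_mul, h1] at h2
    simp only [integral_const, probReal_univ, smul_eq_mul, one_mul] at h2
    push_cast
    linarith

theorem integral_pow_four_sum_le {y : ℕ → Ω → ℝ} (hy : ∀ j, BddMeas m (y j))
    (hyC : ∀ j ω, |y j ω| ≤ C)
    (h1 : ∀ j, ∫ ω, (∑ i ∈ Finset.range j, y i ω) * y j ω ∂μ = 0)
    (h3 : ∀ j, ∫ ω, (∑ i ∈ Finset.range j, y i ω) ^ 3 * y j ω ∂μ = 0) (j : ℕ) :
    ∫ ω, (∑ i ∈ Finset.range j, y i ω) ^ 4 ∂μ ≤ 4 * C ^ 4 * j ^ 2 := by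
  induction j with
  | zero => simp
  | succ j ih =>
    have hs : BddMeas m (fun ω => ∑ i ∈ Finset.range j, y i ω) := BddMeas.sum _ fun i _ => hy i
    have hA : BddMeas m (fun ω => (∑ i ∈ Finset.range j, y i ω) ^ 4 +
          4 * ((∑ i ∈ Finset.range j, y i ω) ^ 3 * y j ω)) :=
      (hs.pow 4).add ((BddMeas.const 4).mul ((hs.pow 3).mul (hy j)))
    have hB : BddMeas m (fun ω => 8 * C ^ 2 * (∑ i ∈ Finset.range j, y i ω) ^ 2) :=
      (BddMeas.const _).mul (hs.pow 2)
    have h2 : ∫ ω, (∑ i ∈ Finset.range (j + 1), y i ω) ^ 4 ∂μ ≤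
        ∫ ω, ((∑ i ∈ Finset.range j, y i ω) ^ 4 +
          4 * ((∑ i ∈ Finset.range j, y i ω) ^ 3 * y j ω) +
          8 * C ^ 2 * (∑ i ∈ Finset.range j, y i ω) ^ 2 + 3 * C ^ 4) ∂μ := by
      refine integral_mono
        (((BddMeas.sum (Finset.range (j + 1)) fun i _ => hy i).pow 4).integrable μ)
        (((hA.add hB).add (BddMeas.const _)).integrable μ) fun ω => ?_
      have h5 := sq_le_sq' (abs_le.1 (hyC j ω)).1 (abs_le.1 (hyC j ω)).2
      have h6 : (y j ω ^ 2) ^ 2 ≤ (C ^ 2) ^ 2 := pow_le_pow_left₀ (sq_nonneg _) h5 2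
      simp only [Finset.sum_range_succ]
      generalize ∑ i ∈ Finset.range j, y i ω = s at *
      generalize y j ω = t at *
      have h7 : 4 * (s * t ^ 3) ≤ 2 * (s ^ 2 * t ^ 2) + 2 * (t ^ 2) ^ 2 := by
        nlinarith [mul_nonneg (sq_nonneg t) (sq_nonneg (s - t))]
      have h8 : s ^ 2 * t ^ 2 ≤ s ^ 2 * C ^ 2 := mul_le_mul_of_nonneg_left h5 (sq_nonneg _)
      have h9 : (s + t) ^ 4 =
          s ^ 4 + 4 * (s ^ 3 * t) + 6 * (s ^ 2 * t ^ 2) + 4 * (s * t ^ 3) + (t ^ 2) ^ 2 := by ring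
      linarith
    rw [integral_add ((hA.add hB).integrable μ) ((BddMeas.const _).integrable μ),
      integral_add (hA.integrable μ) (hB.integrable μ),
      integral_add ((hs.pow 4).integrable μ)
        (((BddMeas.const 4).mul ((hs.pow 3).mul (hy j))).integrable μ),
      integral_const_mul, integral_const_mul, h3] at h2
    simp only [integral_const, probReal_univ, smul_eq_mul, one_mul] at h2
    have h10 := mul_le_mul_of_nonneg_left (integral_sq_sum_le hy hyC h1 j)
      (by positivity : 0 ≤ 8 * C ^ 2)
    have h11 : 0 ≤ C ^ 4 := by positivity
    push_cast
    linarith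

theorem integral_abs_le_of_integral_sq_le {f : Ω → ℝ} (hf : BddMeas m f) {B v : ℝ} (hv : 0 < v)
    (h : ∫ ω, f ω ^ 2 ∂μ ≤ B * v) : ∫ ω, |f ω| ∂μ ≤ (1 + B) * √v := by
  have hs : 0 < √v := Real.sqrt_pos.2 hv
  have h1 : ∫ ω, |f ω| ∂μ ≤ ∫ ω, (√v + f ω ^ 2 / √v) ∂μ := by
    refine integral_mono (hf.abs.integrable μ)
      (((BddMeas.const _).add ((hf.pow 2).div_const _)).integrable μ) fun ω => ?_
    have : √v + f ω ^ 2 / √v = (√v ^ 2 + |f ω| ^ 2) / √v := by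
      rw [sq_abs]; field_simp
    dsimp only
    rw [this, le_div_iff₀ hs]
    nlinarith [sq_nonneg (√v - |f ω|), sq_nonneg (√v), sq_nonneg |f ω|]
  rw [integral_add ((BddMeas.const _).integrable μ) (((hf.pow 2).div_const _).integrable μ),
    integral_div] at h1
  simp only [integral_const, probReal_univ, smul_eq_mul, one_mul] at h1
  have h2 : (∫ ω, f ω ^ 2 ∂μ) / √v ≤ B * √v := by
    rw [div_le_iff₀ hs, mul_assoc, Real.mul_self_sqrt hv.le]
    exact h
  linarith

end Moments

section Quadratic

variable {Ω : Type*} {m : MeasurableSpace Ω} {μ : Measure Ω} [IsProbabilityMeasure μ]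
  {C : ℝ} {x : ℕ → ℕ → Ω → ℝ}

/-- Products of two partial sums, weighted against `q`, are negligible on the scale `v ^ 2`. -/
theorem tendsto_integral_abs_sum_mul_sum_mul (hC : 0 ≤ C) (hx : ∀ k j, BddMeas m (x k j))
    (hxC : ∀ k j ω, |x k j ω| ≤ C)
    (h1 : ∀ k j, ∫ ω, (∑ i ∈ Finset.range j, x k i ω) * x k j ω ∂μ = 0)
    (h3 : ∀ k j, ∫ ω, (∑ i ∈ Finset.range j, x k i ω) ^ 3 * x k j ω ∂μ = 0)
    {q : ℕ → Ω → ℝ} {K : ℝ} (hqm : ∀ j, BddMeas m (q j))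
    (hqK : ∀ j ω, |q j ω| ≤ K) (hq : WindowMeanVanishes μ q) (k l : ℕ) :
    Tendsto (fun v : ℕ => (∫ ω, |∑ j ∈ Finset.range v,
      ((∑ i ∈ Finset.range j, x k i ω) * (∑ i ∈ Finset.range j, x l i ω) / v) * q j ω| ∂μ) / v)
      atTop (𝓝 0) := by
  have hs : ∀ k j, BddMeas m (fun ω => ∑ i ∈ Finset.range j, x k i ω) :=
    fun k j => BddMeas.sum _ fun i _ => hx k i
  have hsq : ∀ k (v j : ℕ), j ≤ v → 0 < v →
      ∫ ω, |∑ i ∈ Finset.range j, x k i ω| ∂μ ≤ (1 + C ^ 2) * √v := fun k v j hj hv => by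
    refine integral_abs_le_of_integral_sq_le (hs k j) (by exact_mod_cast hv)
      ((integral_sq_sum_le (hx k) (hxC k) (h1 k) j).trans ?_)
    exact mul_le_mul_of_nonneg_left (by exact_mod_cast hj) (sq_nonneg C)
  refine tendsto_integral_abs_weighted_sum μ hqm hqK hq (L := 4 * C ^ 4)
    (a := fun v => 2 * C * (1 + C ^ 2) * (1 / √v) + C ^ 2 / v)
    (A := fun v j ω =>
      (∑ i ∈ Finset.range j, x k i ω) * (∑ i ∈ Finset.range j, x l i ω) / v)
    (fun v j => ((hs k j).mul (hs l j)).div_const _) (fun v j hj => ?_) ?_ (fun v j hj => ?_)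
  · rcases Nat.eq_zero_or_pos v with rfl | hv
    · have : 0 ≤ 4 * C ^ 4 := by positivity
      simpa using this
    have hv' : (0 : ℝ) < v := by exact_mod_cast hv
    have h : ∫ ω, ((∑ i ∈ Finset.range j, x k i ω) * (∑ i ∈ Finset.range j, x l i ω) / v) ^ 2 ∂μ
        ≤ ∫ ω, ((∑ i ∈ Finset.range j, x k i ω) ^ 4 +
          (∑ i ∈ Finset.range j, x l i ω) ^ 4) / (2 * v ^ 2) ∂μ := by
      refine integral_mono (((((hs k j).mul (hs l j)).div_const _).pow 2).integrable μ)
        (((((hs k j).pow 4).add ((hs l j).pow 4)).div_const _).integrable μ) fun ω => ?_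
      dsimp only
      generalize ∑ i ∈ Finset.range j, x k i ω = s
      generalize ∑ i ∈ Finset.range j, x l i ω = t
      rw [div_pow, div_le_div_iff₀ (by positivity) (by positivity)]
      have : 2 * (s * t) ^ 2 ≤ s ^ 4 + t ^ 4 := by nlinarith [sq_nonneg (s ^ 2 - t ^ 2)]
      nlinarith [sq_nonneg (v : ℝ)]
    rw [integral_div, integral_add (((hs k j).pow 4).integrable μ)
      (((hs l j).pow 4).integrable μ)] at h
    refine h.trans ?_
    rw [div_le_iff₀ (by positivity)]
    have hj' : (j : ℝ) ^ 2 ≤ (v : ℝ) ^ 2 := by gcongr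
    have a1 := integral_pow_four_sum_le (hx k) (hxC k) (h1 k) (h3 k) j
    have a2 := integral_pow_four_sum_le (hx l) (hxC l) (h1 l) (h3 l) j
    have a3 := mul_le_mul_of_nonneg_left hj' (by positivity : 0 ≤ 4 * C ^ 4)
    linarith
  · have t1 : Tendsto (fun v : ℕ => 1 / √(v : ℝ)) atTop (𝓝 0) := by
      simpa [Function.comp_def] using (tendsto_inv_atTop_zero.comp Real.tendsto_sqrt_atTop).comp
        tendsto_natCast_atTop_atTop
    simpa using (t1.const_mul (2 * C * (1 + C ^ 2))).add
      (tendsto_const_div_atTop_nhds_zero_nat (C ^ 2))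
  · have hv : 0 < v := (Nat.zero_le j).trans_lt hj
    have hv' : (0 : ℝ) < v := by exact_mod_cast hv
    have hB : BddMeas m (fun ω => C * (|∑ i ∈ Finset.range j, x k i ω| +
        |∑ i ∈ Finset.range j, x l i ω|)) :=
      (BddMeas.const C).mul ((hs k j).abs.add (hs l j).abs)
    have h : ∫ ω, |(∑ i ∈ Finset.range (j + 1), x k i ω) *
          (∑ i ∈ Finset.range (j + 1), x l i ω) / v -
          (∑ i ∈ Finset.range j, x k i ω) * (∑ i ∈ Finset.range j, x l i ω) / v| ∂μ ≤
        ∫ ω, (C * (|∑ i ∈ Finset.range j, x k i ω| + |∑ i ∈ Finset.range j, x l i ω|) +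
          C ^ 2) / v ∂μ := by
      refine integral_mono (((((hs k _).mul (hs l _)).div_const _).sub
        (((hs k _).mul (hs l _)).div_const _)).abs.integrable μ)
        (((hB.add (BddMeas.const _)).div_const _).integrable μ) fun ω => ?_
      have b1 := hxC k j ω
      have b2 := hxC l j ω
      simp only [Finset.sum_range_succ]
      generalize ∑ i ∈ Finset.range j, x k i ω = s
      generalize ∑ i ∈ Finset.range j, x l i ω = t
      generalize x k j ω = y at *
      generalize x l j ω = z at *
      rw [← sub_div, abs_div, abs_of_pos hv']
      refine div_le_div_of_nonneg_right ?_ hv'.le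
      have e : (s + y) * (t + z) - s * t = z * s + y * t + y * z := by ring
      rw [e]
      refine (abs_add_three _ _ _).trans ?_
      rw [abs_mul, abs_mul, abs_mul, sq, mul_add]
      gcongr
    refine h.trans ?_
    rw [integral_div, integral_add (hB.integrable μ) ((BddMeas.const _).integrable μ),
      integral_const_mul, integral_add ((hs k j).abs.integrable μ) ((hs l j).abs.integrable μ)]
    simp only [integral_const, probReal_univ, smul_eq_mul, one_mul]
    have a1 := hsq k v j hj.le hv
    have a2 := hsq l v j hj.le hv
    have a3 := mul_le_mul_of_nonneg_left (add_le_add a1 a2) hC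
    rw [add_div]
    refine add_le_add_left ?_ _
    rw [div_le_iff₀ hv']
    have hsv : 0 < √(v : ℝ) := Real.sqrt_pos.2 hv'
    have e : 2 * C * (1 + C ^ 2) * (1 / √(v : ℝ)) * v = 2 * C * (1 + C ^ 2) * √(v : ℝ) := by
      have := Real.mul_self_sqrt hv'.le
      rw [mul_assoc, one_div_mul_eq_div, Real.div_sqrt]
    rw [e]
    linarith

theorem integral_sq_sum_eq_of_orthogonal {Z : ℕ → Ω → ℝ} (hZ : ∀ j, BddMeas m (Z j))
    (h : ∀ i j, i < j → ∫ ω, Z i ω * Z j ω ∂μ = 0) (v : ℕ) :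
    ∫ ω, (∑ j ∈ Finset.range v, Z j ω) ^ 2 ∂μ = ∑ j ∈ Finset.range v, ∫ ω, Z j ω ^ 2 ∂μ := by
  induction v with
  | zero => simp
  | succ v ih =>
    have hs : BddMeas m (fun ω => ∑ j ∈ Finset.range v, Z j ω) := BddMeas.sum _ fun i _ => hZ i
    have h0 : ∫ ω, (∑ j ∈ Finset.range v, Z j ω) * Z v ω ∂μ = 0 := by
      simp only [Finset.sum_mul]
      rw [integral_finsetSum _ fun j _ => ((hZ j).mul (hZ v)).integrable μ]
      exact Finset.sum_eq_zero fun j hj => h j v (Finset.mem_range.1 hj)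
    have e : ∀ ω, (∑ j ∈ Finset.range (v + 1), Z j ω) ^ 2 = (∑ j ∈ Finset.range v, Z j ω) ^ 2 +
        2 * ((∑ j ∈ Finset.range v, Z j ω) * Z v ω) + Z v ω ^ 2 := fun ω => by
      rw [Finset.sum_range_succ]; ring
    simp only [e]
    rw [integral_add (((hs.pow 2).add ((BddMeas.const 2).mul (hs.mul (hZ v)))).integrable μ)
        (((hZ v).pow 2).integrable μ), integral_add ((hs.pow 2).integrable μ)
        (((BddMeas.const 2).mul (hs.mul (hZ v))).integrable μ), integral_const_mul, h0, ih,
      Finset.sum_range_succ]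
    ring

theorem sq_sum_range_eq (y : ℕ → ℝ) (v : ℕ) :
    (∑ j ∈ Finset.range v, y j) ^ 2 = ∑ j ∈ Finset.range v, y j ^ 2 +
      2 * ∑ j ∈ Finset.range v, (∑ i ∈ Finset.range j, y i) * y j := by
  induction v with
  | zero => simp
  | succ v ih =>
    simp only [Finset.sum_range_succ, add_sq, ih]
    ring

/-- The average of the squared normalized sums of `n` orthogonal bounded martingale difference
sequences deviates from `s` in mean by `O(1 / √n)` in the limit. -/
theorem exists_tendsto_integral_abs_average_sq_sub_le (hC : 0 ≤ C)
    (hx : ∀ k j, BddMeas m (x k j)) (hxC : ∀ k j ω, |x k j ω| ≤ C)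
    (h1 : ∀ k j, ∫ ω, (∑ i ∈ Finset.range j, x k i ω) * x k j ω ∂μ = 0)
    (h3 : ∀ k j, ∫ ω, (∑ i ∈ Finset.range j, x k i ω) ^ 3 * x k j ω ∂μ = 0)
    (h4 : ∀ k l i j, i < j → ∫ ω, ((∑ p ∈ Finset.range i, x k p ω) * x k i ω) *
      ((∑ p ∈ Finset.range j, x l p ω) * x l j ω) ∂μ = 0)
    {s : ℝ} (hs0 : 0 ≤ s)
    (hq : ∀ k l, WindowMeanVanishes μ
      (fun j ω => x k j ω * x l j ω - if k = l then s else 0)) {n : ℕ} (hn : 0 < n) :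
    ∃ u : ℕ → ℝ, Tendsto u atTop (𝓝 ((1 + s * C ^ 2) / √n)) ∧ ∀ v : ℕ, 0 < v →
      ∫ ω, |(∑ k ∈ Finset.range n, ((∑ j ∈ Finset.range v, x k j ω) / √v) ^ 2) / n - s| ∂μ ≤
        u v := by
  set q : ℕ → ℕ → ℕ → Ω → ℝ := fun k l j ω => x k j ω * x l j ω - if k = l then s else 0 with hqdef
  set M : ℕ → ℕ → Ω → ℝ := fun k j ω => ∑ i ∈ Finset.range j, x k i ω with hMdef
  have hM : ∀ k j, BddMeas m (M k j) := fun k j => BddMeas.sum _ fun i _ => hx k i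
  have hqm : ∀ k l j, BddMeas m (q k l j) := fun k l j =>
    ((hx k j).mul (hx l j)).sub (BddMeas.const _)
  have hqK : ∀ k l j ω, |q k l j ω| ≤ C ^ 2 + s := fun k l j ω => by
    refine (abs_sub _ _).trans (add_le_add ?_ ?_)
    · rw [abs_mul, sq]
      exact mul_le_mul (hxC k j ω) (hxC l j ω) (abs_nonneg _) hC
    · split_ifs <;> simp [abs_of_nonneg hs0, hs0]
  set α : ℕ → ℕ → ℝ := fun k v => (∫ ω, |∑ j ∈ Finset.range v, q k k j ω| ∂μ) / v with hα
  set β : ℕ → ℕ → ℕ → ℝ := fun k l v =>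
    (∫ ω, |∑ j ∈ Finset.range v, (M k j ω * M l j ω / v) * q k l j ω| ∂μ) / v with hβ
  have hαlim : ∀ k, Tendsto (α k) atTop (𝓝 0) := fun k => by
    simpa using tendsto_integral_abs_weighted_sum μ (hqm k k) (hqK k k) (hq k k)
      (A := fun _ _ _ => 1) (fun _ _ => BddMeas.const 1) (L := 1) (by simp)
      (a := fun _ => 0) tendsto_const_nhds (by simp)
  have hβlim : ∀ k l, Tendsto (β k l) atTop (𝓝 0) := fun k l =>
    tendsto_integral_abs_sum_mul_sum_mul hC hx hxC h1 h3 (hqm k l) (hqK k l) (hq k l) k l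
  have hn' : (0 : ℝ) < n := by exact_mod_cast hn
  have hsn : 0 < √(n : ℝ) := Real.sqrt_pos.2 hn'
  set Z : ℕ → Ω → ℝ := fun j ω => ∑ k ∈ Finset.range n, M k j ω * x k j ω with hZdef
  have hZ : ∀ j, BddMeas m (Z j) := fun j => BddMeas.sum _ fun k _ => (hM k j).mul (hx k j)
  have hZorth : ∀ i j, i < j → ∫ ω, Z i ω * Z j ω ∂μ = 0 := fun i j hij => by
    simp only [hZdef, Finset.sum_mul_sum]
    rw [integral_finsetSum _ fun k _ => (BddMeas.sum _ fun l _ =>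
      ((hM k i).mul (hx k i)).mul ((hM l j).mul (hx l j))).integrable μ]
    refine Finset.sum_eq_zero fun k _ => ?_
    rw [integral_finsetSum _ fun l _ =>
      (((hM k i).mul (hx k i)).mul ((hM l j).mul (hx l j))).integrable μ]
    exact Finset.sum_eq_zero fun l _ => h4 k l i j hij
  have hW : ∀ v : ℕ, 0 < v → (∫ ω, (∑ j ∈ Finset.range v, Z j ω) ^ 2 ∂μ) / v ^ 2 ≤
      ∑ k ∈ Finset.range n, ∑ l ∈ Finset.range n, β k l v + n * (s * C ^ 2) := by
    intro v hv
    have hv' : (0 : ℝ) < v := by exact_mod_cast hv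
    rw [integral_sq_sum_eq_of_orthogonal hZ hZorth,
      ← integral_finsetSum _ fun j _ => ((hZ j).pow 2).integrable μ]
    have hR : ∀ k l, BddMeas m (fun ω => |∑ j ∈ Finset.range v,
        (M k j ω * M l j ω / v) * q k l j ω|) := fun k l =>
      (BddMeas.sum _ fun j _ => (((hM k j).mul (hM l j)).div_const _).mul (hqm k l j)).abs
    have hD : BddMeas m (fun ω => s * ∑ k ∈ Finset.range n, ∑ j ∈ Finset.range v, M k j ω ^ 2) :=
      (BddMeas.const s).mul (BddMeas.sum _ fun k _ => BddMeas.sum _ fun j _ => (hM k j).pow 2)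
    have hR' : BddMeas m (fun ω => v * ∑ k ∈ Finset.range n, ∑ l ∈ Finset.range n,
        |∑ j ∈ Finset.range v, (M k j ω * M l j ω / v) * q k l j ω|) :=
      (BddMeas.const _).mul (BddMeas.sum _ fun k _ => BddMeas.sum _ fun l _ => hR k l)
    have hle : ∫ ω, ∑ j ∈ Finset.range v, Z j ω ^ 2 ∂μ ≤
        ∫ ω, (v * (∑ k ∈ Finset.range n, ∑ l ∈ Finset.range n,
          |∑ j ∈ Finset.range v, (M k j ω * M l j ω / v) * q k l j ω|) +
          s * ∑ k ∈ Finset.range n, ∑ j ∈ Finset.range v, M k j ω ^ 2) ∂μ := by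
      refine integral_mono ((BddMeas.sum _ fun j _ => (hZ j).pow 2).integrable μ)
        ((hR'.add hD).integrable μ) fun ω => ?_
      have e1 : ∀ j, Z j ω ^ 2 = ∑ k ∈ Finset.range n, ∑ l ∈ Finset.range n,
          v * ((M k j ω * M l j ω / v) * q k l j ω) +
          s * ∑ k ∈ Finset.range n, M k j ω ^ 2 := fun j => by
        rw [sq, hZdef, Finset.sum_mul_sum, Finset.mul_sum, ← Finset.sum_add_distrib]
        refine Finset.sum_congr rfl fun k hk => ?_
        have e2 : s * M k j ω ^ 2 = ∑ l ∈ Finset.range n,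
            M k j ω * M l j ω * (if k = l then s else 0) := by
          simp only [mul_ite, mul_zero, Finset.sum_ite_eq, hk, if_true]
          ring
        rw [e2, ← Finset.sum_add_distrib]
        refine Finset.sum_congr rfl fun l _ => ?_
        simp only [hqdef]
        field_simp
        ring
      dsimp only
      simp only [e1, Finset.sum_add_distrib, ← Finset.mul_sum]
      rw [Finset.sum_comm (s := Finset.range v) (t := Finset.range n)
        (f := fun j k => M k j ω ^ 2)]
      refine add_le_add_left (mul_le_mul_of_nonneg_left ?_ hv'.le) _
      rw [Finset.sum_comm]
      refine Finset.sum_le_sum fun k _ => ?_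
      rw [Finset.sum_comm]
      exact Finset.sum_le_sum fun l _ => le_abs_self _
    rw [integral_add (hR'.integrable μ) (hD.integrable μ), integral_const_mul, integral_const_mul,
      integral_finsetSum _ fun k _ => (BddMeas.sum _ fun l _ => hR k l).integrable μ,
      integral_finsetSum _ fun k _ =>
        (BddMeas.sum _ fun j _ => (hM k j).pow 2).integrable μ] at hle
    have e3 : ∑ k ∈ Finset.range n, ∫ ω, ∑ l ∈ Finset.range n,
        |∑ j ∈ Finset.range v, (M k j ω * M l j ω / v) * q k l j ω| ∂μ =
        v * ∑ k ∈ Finset.range n, ∑ l ∈ Finset.range n, β k l v := by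
      rw [Finset.mul_sum]
      refine Finset.sum_congr rfl fun k _ => ?_
      rw [integral_finsetSum _ fun l _ => (hR k l).integrable μ, Finset.mul_sum]
      refine Finset.sum_congr rfl fun l _ => ?_
      simp only [hβ]
      field_simp
    have e4 : ∑ k ∈ Finset.range n, ∫ ω, ∑ j ∈ Finset.range v, M k j ω ^ 2 ∂μ ≤
        n * (v * (C ^ 2 * v)) := by
      refine (Finset.sum_le_card_nsmul _ _ (v * (C ^ 2 * v)) fun k _ => ?_).trans (by simp)
      rw [integral_finsetSum _ fun j _ => ((hM k j).pow 2).integrable μ]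
      refine (Finset.sum_le_card_nsmul _ _ (C ^ 2 * v) fun j hj => ?_).trans (by simp)
      refine (integral_sq_sum_le (hx k) (hxC k) (h1 k) j).trans
        (mul_le_mul_of_nonneg_left ?_ (sq_nonneg C))
      exact_mod_cast (Finset.mem_range.1 hj).le
    rw [e3] at hle
    rw [div_le_iff₀ (by positivity)]
    have e5 := mul_le_mul_of_nonneg_left e4 hs0
    linarith
  refine ⟨fun v => (∑ k ∈ Finset.range n, α k v) / n + (1 / √n + √n / n ^ 2 *
    (∑ k ∈ Finset.range n, ∑ l ∈ Finset.range n, β k l v + n * (s * C ^ 2))), ?_, ?_⟩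
  · have l1 : Tendsto (fun v => ∑ k ∈ Finset.range n, α k v) atTop (𝓝 0) := by
      simpa using tendsto_finsetSum (Finset.range n) fun k _ => hαlim k
    have l2 : Tendsto (fun v => ∑ k ∈ Finset.range n, ∑ l ∈ Finset.range n, β k l v) atTop
        (𝓝 0) := by
      simpa using tendsto_finsetSum (Finset.range n) fun k _ =>
        tendsto_finsetSum (Finset.range n) fun l _ => hβlim k l
    have l3 := (l1.div_const (n : ℝ)).add
      (((l2.add_const (n * (s * C ^ 2))).const_mul (√n / (n : ℝ) ^ 2)).const_add (1 / √n))
    convert l3 using 2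
    have hr : (n : ℝ) = √n * √n := (Real.mul_self_sqrt hn'.le).symm
    generalize √(n : ℝ) = r at *
    rw [hr]
    field_simp
    ring
  · intro v hv
    have hv' : (0 : ℝ) < v := by exact_mod_cast hv
    have hsum : ∀ k, BddMeas m (fun ω => |∑ j ∈ Finset.range v, q k k j ω|) := fun k =>
      (BddMeas.sum _ fun j _ => hqm k k j).abs
    have hZ2 : BddMeas m (fun ω => (∑ j ∈ Finset.range v, Z j ω) ^ 2) :=
      (BddMeas.sum _ fun j _ => hZ j).pow 2
    have hA : BddMeas m (fun ω => (∑ k ∈ Finset.range n,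
        |∑ j ∈ Finset.range v, q k k j ω| / v) / n) :=
      (BddMeas.sum _ fun k _ => (hsum k).div_const _).div_const _
    have hB : BddMeas m (fun ω => 1 / √n + √n / n ^ 2 *
        ((∑ j ∈ Finset.range v, Z j ω) ^ 2 / v ^ 2)) :=
      (BddMeas.const _).add ((BddMeas.const _).mul (hZ2.div_const _))
    have hle : ∫ ω, |(∑ k ∈ Finset.range n,
        ((∑ j ∈ Finset.range v, x k j ω) / √v) ^ 2) / n - s| ∂μ ≤
        ∫ ω, ((∑ k ∈ Finset.range n, |∑ j ∈ Finset.range v, q k k j ω| / v) / n +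
          (1 / √n + √n / n ^ 2 * ((∑ j ∈ Finset.range v, Z j ω) ^ 2 / v ^ 2))) ∂μ := by
      refine integral_mono ((((BddMeas.sum (Finset.range n) fun k _ =>
        ((hM k v).div_const (√v)).pow 2).div_const (n : ℝ)).sub
          (BddMeas.const s)).abs.integrable μ) ((hA.add hB).integrable μ) fun ω => ?_
      have e1 : (∑ k ∈ Finset.range n, ((∑ j ∈ Finset.range v, x k j ω) / √v) ^ 2) / n - s =
          (∑ k ∈ Finset.range n, (∑ j ∈ Finset.range v, q k k j ω) / v) / n +
            2 * ((∑ j ∈ Finset.range v, Z j ω) / (n * v)) := by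
        have e2 : ∀ k, ((∑ j ∈ Finset.range v, x k j ω) / √v) ^ 2 =
            (∑ j ∈ Finset.range v, q k k j ω) / v + s +
              2 * ((∑ j ∈ Finset.range v, M k j ω * x k j ω) / v) := fun k => by
          rw [div_pow, Real.sq_sqrt hv'.le, sq_sum_range_eq]
          simp only [hqdef, if_true, Finset.sum_sub_distrib, Finset.sum_const, Finset.card_range,
            nsmul_eq_mul, hMdef, sq]
          field_simp
          ring
        simp only [e2, Finset.sum_add_distrib, Finset.sum_const, Finset.card_range,
          nsmul_eq_mul, hZdef]
        rw [Finset.sum_comm (s := Finset.range v), ← Finset.mul_sum,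
          ← Finset.sum_div (Finset.range n)
            (fun k => ∑ j ∈ Finset.range v, M k j ω * x k j ω)]
        field_simp
        ring
      dsimp only
      rw [e1]
      refine (abs_add_le _ _).trans (add_le_add ?_ ?_)
      · rw [abs_div, abs_of_pos hn']
        refine div_le_div_of_nonneg_right ((Finset.abs_sum_le_sum_abs _ _).trans
          (le_of_eq (Finset.sum_congr rfl fun k _ => ?_))) hn'.le
        rw [abs_div, abs_of_pos hv']
      · generalize ∑ j ∈ Finset.range v, Z j ω = w
        have e3 : √(n : ℝ) / n ^ 2 * (w ^ 2 / v ^ 2) = √n * (w / (n * v)) ^ 2 := by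
          field_simp
        rw [e3]
        generalize w / (n * v) = y
        have e4 : 1 / √(n : ℝ) + √n * y ^ 2 - 2 * |y| = √n * (1 / √n - |y|) ^ 2 := by
          rw [sub_sq, sq_abs]
          field_simp
          ring
        rw [abs_mul, abs_two]
        have : 0 ≤ √(n : ℝ) * (1 / √n - |y|) ^ 2 := by positivity
        linarith
    rw [integral_add (hA.integrable μ) (hB.integrable μ),
      integral_add ((BddMeas.const _).integrable μ)
        (((BddMeas.const _).mul (hZ2.div_const _)).integrable μ), integral_div,
      integral_finsetSum _ fun k _ => ((hsum k).div_const _).integrable μ,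
      integral_const_mul, integral_div] at hle
    simp only [integral_const, probReal_univ, smul_eq_mul, one_mul, integral_div] at hle
    have := mul_le_mul_of_nonneg_left (hW v hv) (by positivity : 0 ≤ √(n : ℝ) / n ^ 2)
    simp only [hα]
    linarith

end Quadratic

section CondExp

variable {Ω : Type*} {m1 m2 : MeasurableSpace Ω} [m0 : MeasurableSpace Ω] {P : Measure Ω}
  [IsProbabilityMeasure P]

theorem condExp_iSup_ae_eq_zero {ℱ : ℤ → MeasurableSpace Ω} (hmono : Monotone ℱ)
    (hle : ∀ n, ℱ n ≤ m0) {f : Ω → ℝ} (h : ∀ n, P[f | ℱ n] =ᵐ[P] 0) :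
    P[f | ⨆ n, ℱ n] =ᵐ[P] 0 := by
  let 𝒢 : Filtration ℕ m0 :=
    { seq := fun n => ℱ n
      mono' := fun a b hab => hmono (by exact_mod_cast hab)
      le' := fun n => hle n }
  have hsup : ⨆ n, 𝒢 n = ⨆ n, ℱ n := by
    refine le_antisymm (iSup_le fun n => le_iSup ℱ n) (iSup_le fun n => ?_)
    exact (hmono (Int.self_le_toNat n)).trans (le_iSup (fun n => 𝒢 n) n.toNat)
  rw [← hsup]
  filter_upwards [tendsto_ae_condExp (ℱ := 𝒢) (μ := P) f, ae_all_iff.2 fun n : ℕ => h n]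
    with ω h1 h2
  refine tendsto_nhds_unique h1 (tendsto_const_nhds.congr fun n => (h2 n).symm)

theorem condExp_mul_ae_eq_zero (h2 : m2 ≤ m0) {Y f : Ω → ℝ} (hY : BddMeas m2 Y)
    (hf : BddMeas m0 f) (h : P[f | m2] =ᵐ[P] 0) : P[fun ω => Y ω * f ω | m2] =ᵐ[P] 0 := by
  have h3 := condExp_mul_of_stronglyMeasurable_left (μ := P) hY.1.stronglyMeasurable
    (((hY.mono h2).mul hf).integrable P) (hf.integrable P)
  filter_upwards [h3, h] with ω a1 a2
  refine a1.trans ?_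
  simp [a2]

theorem integral_mul_eq_zero_of_condExp (h2 : m2 ≤ m0) {Y f : Ω → ℝ} (hY : BddMeas m2 Y)
    (hf : BddMeas m0 f) (h : P[f | m2] =ᵐ[P] 0) : ∫ ω, Y ω * f ω ∂P = 0 := by
  rw [← integral_condExp h2, integral_congr_ae (condExp_mul_ae_eq_zero h2 hY hf h)]
  simp

variable [StandardBorelSpace Ω]

theorem ae_integral_mul_condExpKernel_eq_zero (h12 : m1 ≤ m2) (h2 : m2 ≤ m0) {Y f : Ω → ℝ}
    (hY : BddMeas m2 Y) (hf : BddMeas m0 f) (h : P[f | m2] =ᵐ[P] 0) :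
    ∀ᵐ ω ∂P, ∫ ω', Y ω' * f ω' ∂(condExpKernel P m1 ω) = 0 := by
  have h3 := condExp_ae_eq_integral_condExpKernel (μ := P) (h12.trans h2)
    (((hY.mono h2).mul hf).integrable P)
  have h4 := condExp_condExp_of_le (μ := P) (f := fun ω => Y ω * f ω) h12 h2
  have h5 : P[P[fun ω => Y ω * f ω | m2] | m1] =ᵐ[P] 0 := by
    refine (condExp_congr_ae (condExp_mul_ae_eq_zero h2 hY hf h)).trans ?_
    rw [condExp_zero]
  filter_upwards [h3, h4, h5] with ω a3 a4 a5
  rw [← a3, ← a4, a5]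
  rfl

theorem ae_ae_condExpKernel (h1 : m1 ≤ m0) {p : Ω → Prop} (h : ∀ᵐ ω ∂P, p ω) :
    ∀ᵐ ω ∂P, ∀ᵐ ω' ∂(condExpKernel P m1 ω), p ω' := by
  rw [← condExpKernel_comp_trim (μ := P) h1] at h
  exact ae_of_ae_trim h1 (Measure.ae_ae_of_ae_comp h)

/-- For an ergodic stationary centred sequence, the sliding window averages vanish under almost
every conditional measure. -/
theorem ae_windowMeanVanishes_condExpKernel (h1 : m1 ≤ m0) {τ : Ω → Ω} (hτ : Ergodic τ P)
    {g : Ω → ℝ} (hg : BddMeas m0 g) (hg0 : ∫ ω, g ω ∂P = 0) :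
    ∀ᵐ ω ∂P, WindowMeanVanishes (condExpKernel P m1 ω) (fun j ω' => g (τ^[j] ω')) := by
  have hτi : ∀ i, Measurable (τ^[i]) := fun i => hτ.measurable.iterate i
  have hh : ∀ b : ℕ, BddMeas m0
      (fun ω => ((∑ i ∈ Finset.range b, g (τ^[i] ω)) / b) ^ 2) := fun b =>
    ((BddMeas.sum _ fun i _ => hg.comp (hτi i)).div_const _).pow 2
  have hbk : ∀ᵐ ω ∂P, ∀ b : ℕ, ∀ᵐ ω' ∂(condExpKernel P m1 ω), Tendsto (fun n : ℕ =>
      (∑ j ∈ Finset.range n, ((∑ i ∈ Finset.range b, g (τ^[i] (τ^[j] ω'))) / b) ^ 2) / n) atTop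
      (𝓝 (∫ y, ((∑ i ∈ Finset.range b, g (τ^[i] y)) / b) ^ 2 ∂P)) :=
    ae_all_iff.2 fun b => ae_ae_condExpKernel h1 (hτ.ae_tendsto_birkhoff (hh b))
  filter_upwards [hbk] with ω hω
  refine ⟨fun b => ∫ y, ((∑ i ∈ Finset.range b, g (τ^[i] y)) / b) ^ 2 ∂P, ?_, fun b _ => ?_⟩
  · obtain ⟨B, hB⟩ := hg.2
    rw [← integral_zero Ω ℝ (μ := P)]
    refine tendsto_integral_of_dominated_convergence (fun _ => B ^ 2)
      (fun b => (hh b).1.aestronglyMeasurable) (integrable_const _)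
      (fun b => ae_of_all _ fun y => ?_) ?_
    · have h2 : |(∑ i ∈ Finset.range b, g (τ^[i] y)) / b| ≤ B := by
        have hB0 : 0 ≤ B := (abs_nonneg _).trans (hB y)
        rw [abs_div, Nat.abs_cast]
        refine div_le_of_le_mul₀ (Nat.cast_nonneg _) hB0 ?_
        refine (Finset.abs_sum_le_sum_abs _ _).trans ?_
        refine (Finset.sum_le_card_nsmul _ _ B fun i _ => hB _).trans ?_
        simp [mul_comm]
      rw [Real.norm_eq_abs, abs_pow]
      exact pow_le_pow_left₀ (abs_nonneg _) h2 2
    · filter_upwards [hτ.ae_tendsto_birkhoff hg] with y hy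
      rw [hg0] at hy
      simpa using hy.pow 2
  · obtain ⟨B, hB⟩ := (hh b).2
    have e : ∀ v : ℕ, (∑ j ∈ Finset.range v, ∫ y,
        ((∑ i ∈ Finset.range b, g (τ^[j + i] y)) / b) ^ 2 ∂(condExpKernel P m1 ω)) / v =
        ∫ y, (∑ j ∈ Finset.range v,
          ((∑ i ∈ Finset.range b, g (τ^[i] (τ^[j] y))) / b) ^ 2) / v
          ∂(condExpKernel P m1 ω) := fun v => by
      rw [integral_div, integral_finsetSum _ fun j _ => ((hh b).comp (hτi j)).integrable _]
      simp only [← Function.iterate_add_apply, add_comm]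
    simp only [e]
    have hlim := tendsto_integral_of_dominated_convergence (μ := condExpKernel P m1 ω)
      (F := fun (v : ℕ) y => (∑ j ∈ Finset.range v,
          ((∑ i ∈ Finset.range b, g (τ^[i] (τ^[j] y))) / b) ^ 2) / v)
      (f := fun _ => ∫ y, ((∑ i ∈ Finset.range b, g (τ^[i] y)) / b) ^ 2 ∂P) (fun _ => B)
      (fun v => ((BddMeas.sum _ fun j _ => (hh b).comp (hτi j)).div_const
        _).1.aestronglyMeasurable) (integrable_const _)
      (fun v => ae_of_all _ fun y => ?_) (hω b)
    · simpa using hlim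
    · have hB0 : 0 ≤ B := (abs_nonneg _).trans (hB y)
      rw [Real.norm_eq_abs, abs_div, Nat.abs_cast]
      refine div_le_of_le_mul₀ (Nat.cast_nonneg _) hB0 ?_
      refine (Finset.abs_sum_le_sum_abs _ _).trans ?_
      refine (Finset.sum_le_card_nsmul _ _ B fun i _ => hB _).trans ?_
      simp [mul_comm]

end CondExp

theorem limsup_mem_Icc_of_le {g u : ℕ → ℝ} {c : ℝ} (hu : Tendsto u atTop (𝓝 c))
    (hg0 : ∀ v, 0 ≤ g v) (hgu : ∀ᶠ v in atTop, g v ≤ u v) :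
    limsup g atTop ∈ Set.Icc 0 c := by
  have hbdd : IsBoundedUnder (· ≤ ·) atTop g := hu.isBoundedUnder_le.mono_le hgu
  refine ⟨le_limsup_of_frequently_le (Frequently.of_forall hg0) hbdd, ?_⟩
  rw [← hu.limsup_eq]
  exact limsup_le_limsup hgu
    (isBoundedUnder_of ⟨0, hg0⟩ : IsBoundedUnder (· ≥ ·) atTop g).isCoboundedUnder_le
    hu.isBoundedUnder_le

/-- Quenched averaging for a uniformly bounded orthomartingale difference array that is stationary
and ergodic in the second coordinate. -/
theorem ae_tendsto_limsup_integral_condExpKernel {Ω : Type*} (F : ℤ → ℤ → MeasurableSpace Ω)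
    [m0 : MeasurableSpace Ω] [StandardBorelSpace Ω] {P : Measure Ω} [IsProbabilityMeasure P]
    (hF1 : ∀ j, Monotone fun i => F i j) (hF2 : ∀ i, Monotone (F i)) (hF0 : ∀ i j, F i j ≤ m0)
    {x : ℕ → ℕ → Ω → ℝ} (hxm : ∀ k j : ℕ, BddMeas (F k j) (x k j)) {C : ℝ} (hC : 0 ≤ C)
    (hxC : ∀ k j ω, |x k j ω| ≤ C)
    (hortho : ∀ (k j : ℕ) (u v : ℤ), (u < k ∨ v < j) → P[x k j | F u v] =ᵐ[P] 0)
    {τ : Ω → Ω} (hτ : Ergodic τ P) (hxτ : ∀ k j ω, x k j ω = x k 0 (τ^[j] ω))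
    {s : ℝ} (hs : ∀ k, ∫ ω, x k 0 ω * x k 0 ω ∂P = s) :
    ∀ᵐ ω ∂P, Tendsto (fun n : ℕ => limsup (fun v : ℕ => ∫ ω', |(∑ k ∈ Finset.range n,
      ((∑ j ∈ Finset.range v, x k j ω') / √v) ^ 2) / n - s|
        ∂(condExpKernel P (⨆ n : ℤ, F n 0) ω)) atTop) atTop (𝓝 0) := by
  set H : ℤ → MeasurableSpace Ω := fun j => ⨆ n : ℤ, F n j with hH
  have hHmono : Monotone H := fun a b hab => iSup_mono fun n => hF2 n hab
  have hHle : ∀ j, H j ≤ m0 := fun j => iSup_le fun n => hF0 n j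
  have hx : ∀ k j, BddMeas m0 (x k j) := fun k j => (hxm k j).mono (hF0 _ _)
  have hs0 : 0 ≤ s := hs 0 ▸ integral_nonneg fun ω => mul_self_nonneg _
  have hdiff : ∀ k j : ℕ, P[x k (j + 1) | H j] =ᵐ[P] 0 := fun k j =>
    condExp_iSup_ae_eq_zero (hF1 j) (fun n => hF0 n j) fun n =>
      hortho k (j + 1) n j (Or.inr (by push_cast; linarith))
  have hxH : ∀ (k i j : ℕ), i ≤ j → BddMeas (H j) (x k i) := fun k i j hij =>
    (hxm k i).mono ((hF2 k (by exact_mod_cast hij)).trans (le_iSup (fun n => F n j) k))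
  have hM : ∀ (k i j : ℕ), i ≤ j + 1 → BddMeas (H j) (fun ω => ∑ p ∈ Finset.range i, x k p ω) :=
    fun k i j hij => BddMeas.sum _ fun p hp => hxH k p j
      (by have := Finset.mem_range.1 hp; omega)
  have key : ∀ (j : ℕ) (Y : Ω → ℝ) (k : ℕ), BddMeas (H j) Y →
      ∀ᵐ ω ∂P, ∫ ω', Y ω' * x k (j + 1) ω' ∂(condExpKernel P (H 0) ω) = 0 := fun j Y k hY =>
    ae_integral_mul_condExpKernel_eq_zero (hHmono (by positivity)) (hHle j) hY (hx k _)
      (hdiff k j)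
  have h1 : ∀ᵐ ω ∂P, ∀ k j, ∫ ω', (∑ i ∈ Finset.range j, x k i ω') * x k j ω'
      ∂(condExpKernel P (H 0) ω) = 0 := by
    refine ae_all_iff.2 fun k => ae_all_iff.2 fun j => ?_
    cases j with
    | zero => simp
    | succ j => exact key j _ k (hM k _ j le_rfl)
  have h3 : ∀ᵐ ω ∂P, ∀ k j, ∫ ω', (∑ i ∈ Finset.range j, x k i ω') ^ 3 * x k j ω'
      ∂(condExpKernel P (H 0) ω) = 0 := by
    refine ae_all_iff.2 fun k => ae_all_iff.2 fun j => ?_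
    cases j with
    | zero => simp
    | succ j => exact key j _ k ((hM k _ j le_rfl).pow 3)
  have h4 : ∀ᵐ ω ∂P, ∀ k l i j, i < j → ∫ ω', ((∑ p ∈ Finset.range i, x k p ω') * x k i ω') *
      ((∑ p ∈ Finset.range j, x l p ω') * x l j ω') ∂(condExpKernel P (H 0) ω) = 0 := by
    simp only [ae_all_iff]
    intro k l i j hij
    cases j with
    | zero => omega
    | succ j =>
      simp only [← mul_assoc]
      exact key j _ l (((hM k i j (by omega)).mul (hxH k i j (by omega))).mul (hM l _ j le_rfl))
  have hcov : ∀ k l, ∫ ω, (x k 0 ω * x l 0 ω - if k = l then s else 0) ∂P = 0 := by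
    have hlt : ∀ k l, k < l → ∫ ω, x k 0 ω * x l 0 ω ∂P = 0 := fun k l hkl =>
      integral_mul_eq_zero_of_condExp (hF0 k 0) (hxm k 0) (hx l 0)
        (hortho l 0 k 0 (Or.inl (by exact_mod_cast hkl)))
    intro k l
    rw [integral_sub (((hx k 0).mul (hx l 0)).integrable P) (integrable_const _)]
    rcases lt_trichotomy k l with h | rfl | h
    · simp [h.ne, hlt k l h]
    · simp [hs]
    · simp only [mul_comm (x k 0 _)]
      simp [h.ne', hlt l k h]
  have hq : ∀ᵐ ω ∂P, ∀ k l, WindowMeanVanishes (condExpKernel P (H 0) ω)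
      (fun j ω => x k j ω * x l j ω - if k = l then s else 0) := by
    refine ae_all_iff.2 fun k => ae_all_iff.2 fun l => ?_
    have h := ae_windowMeanVanishes_condExpKernel (hHle 0) hτ
      (((hx k 0).mul (hx l 0)).sub (BddMeas.const (if k = l then s else 0))) (hcov k l)
    simpa only [← hxτ] using h
  filter_upwards [h1, h3, h4, hq] with ω h1 h3 h4 hq
  have hmem : ∀ n : ℕ, 0 < n → limsup (fun v : ℕ => ∫ ω', |(∑ k ∈ Finset.range n,
      ((∑ j ∈ Finset.range v, x k j ω') / √v) ^ 2) / n - s|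
        ∂(condExpKernel P (H 0) ω)) atTop ∈ Set.Icc 0 ((1 + s * C ^ 2) / √n) := fun n hn => by
    obtain ⟨u, hu, hle⟩ :=
      exists_tendsto_integral_abs_average_sq_sub_le hC hx hxC h1 h3 h4 hs0 hq hn
    exact limsup_mem_Icc_of_le hu (fun v => integral_nonneg fun ω' => abs_nonneg _)
      ((eventually_gt_atTop 0).mono hle)
  have hlim : Tendsto (fun n : ℕ => (1 + s * C ^ 2) / √(n : ℝ)) atTop (𝓝 0) :=
    (Real.tendsto_sqrt_atTop.comp tendsto_natCast_atTop_atTop).const_div_atTop _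
  exact squeeze_zero' ((eventually_gt_atTop 0).mono fun n hn => (hmem n hn).1)
    ((eventually_gt_atTop 0).mono fun n hn => (hmem n hn).2) hlim

/-- **The key ergodic averaging step in the proof of the quenched CLT**
(Peligrad–Volný, relation (13) in the proof of Theorem 1): for a bounded
orthomartingale difference field with ergodic `S`, writing
`F_{k,v} = v^{-1/2} Σ_{j<v} X_{k,j}` and `E_{∞,0}` for the conditional expectation
given `F_{∞,0} = σ(∪_n F_{n,0})`, one has, almost surely,
`lim_{m→∞} limsup_{v→∞} E_{∞,0} | m⁻¹ Σ_{k<m} F_{k,v}² − σ² | = 0`. -/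
theorem quenched_clt_averaging_step
    {Ω : Type*} (F00 : MeasurableSpace Ω)
    [m0 : MeasurableSpace Ω] [StandardBorelSpace Ω] [Nonempty Ω]
    (P : Measure Ω) [IsProbabilityMeasure P]
    -- `T` and `S` are commuting, invertible, bimeasurable, measure-preserving
    -- transformations, encoded together with all their integer iterates
    (T S : ℤ → Ω → Ω)
    (hTmp : ∀ i, MeasurePreserving (T i) P P)
    (hSmp : ∀ j, MeasurePreserving (S j) P P)
    (hT0 : T 0 = id) (hS0 : S 0 = id)
    (hTadd : ∀ i i', T (i + i') = T i ∘ T i')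
    (hSadd : ∀ j j', S (j + j') = S j ∘ S j')
    (hTS : ∀ i j, T i ∘ S j = S j ∘ T i)
    -- the filtration `F i j = T^{-i} S^{-j} (F 0 0)`
    (hF00 : F00 ≤ m0)
    (F : ℤ → ℤ → MeasurableSpace Ω)
    (hF : ∀ i j, F i j = MeasurableSpace.comap (fun ω => T i (S j ω)) F00)
    -- the filtration is increasing in each coordinate
    (hincrT : F 0 0 ≤ F 1 0) (hincrS : F 0 0 ≤ F 0 1)
    -- the filtration is commuting
    (hcom : ∀ f : Ω → ℝ, Integrable f P → ∀ a b u v : ℤ,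
      P[ (P[f | F a b]) | F u v ] =ᵐ[P] P[f | F (min a u) (min b v)])
    -- the stationary random field
    (X00 : Ω → ℝ) (hX00meas : Measurable[F 0 0] X00)
    (X : ℤ → ℤ → Ω → ℝ)
    (hX : ∀ i j, X i j = fun ω => X00 (T i (S j ω)))
    -- orthomartingale differences
    (hortho : ∀ i j u v : ℤ, (u < i ∨ v < j) → P[ X i j | F u v ] =ᵐ[P] 0)
    -- boundedness, ergodicity of `S`, and the variance
    (C : ℝ) (hC : 0 < C) (hbd : ∀ᵐ ω ∂P, |X00 ω| ≤ C)
    (hSerg : Ergodic (S 1) P)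
    (σ : ℝ) (hσ : ∫ ω, (X00 ω) ^ 2 ∂P = σ ^ 2)
    -- the normalized column sums `F_{k,v}`
    (Fkv : ℕ → ℕ → Ω → ℝ)
    (hFkv : ∀ k v, Fkv k v =
      fun ω => (∑ j ∈ Finset.range v, X (k : ℤ) (j : ℤ) ω) / Real.sqrt v)
    -- the σ-algebra `F_{∞,0}` and the conditional expectations `E_{∞,0}|⋯|`
    (Finf0 : MeasurableSpace Ω) (hFinf0 : Finf0 = ⨆ n : ℤ, F n 0)
    (G : ℕ → ℕ → Ω → ℝ)
    (hG : ∀ m v, G m v =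
      P[ (fun x => |(∑ k ∈ Finset.range m, (Fkv k v x) ^ 2) / (m : ℝ) - σ ^ 2|)
        | Finf0 ]) :
    ∀ᵐ ω ∂P,
      Tendsto (fun m : ℕ => Filter.limsup (fun v : ℕ => G m v ω) atTop)
        atTop (𝓝 0) := by
  subst hFinf0
  have hF0 : F 0 0 = F00 := by
    rw [hF, hT0, hS0]
    exact MeasurableSpace.comap_id
  have hTSm : ∀ i j, MeasurePreserving (fun ω => T i (S j ω)) P P := fun i j =>
    (hTmp i).comp (hSmp j)
  have hFle : ∀ i j, F i j ≤ m0 := fun i j => by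
    rw [hF]
    exact (MeasurableSpace.comap_mono hF00).trans (hTSm i j).measurable.comap_le
  have hT1 : F00 ≤ MeasurableSpace.comap (T 1) F00 := by
    rw [hF0, hF, hS0] at hincrT
    exact hincrT
  have hS1 : F00 ≤ MeasurableSpace.comap (S 1) F00 := by
    rw [hF0, hF, hT0] at hincrS
    exact hincrS
  have hmono1 : ∀ j, Monotone fun i => F i j := fun j => monotone_int_of_le_succ fun i => by
    simp only [hF]
    refine (MeasurableSpace.comap_mono hT1).trans (le_of_eq ?_)
    rw [MeasurableSpace.comap_comp, add_comm i 1, hTadd]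
    rfl
  have hmono2 : ∀ i, Monotone (F i) := fun i => monotone_int_of_le_succ fun j => by
    simp only [hF]
    refine (MeasurableSpace.comap_mono hS1).trans (le_of_eq ?_)
    rw [MeasurableSpace.comap_comp]
    congr 1
    funext ω
    rw [add_comm j 1, hSadd]
    exact (congrFun (hTS i 1) (S j ω)).symm
  set Y : Ω → ℝ := fun ω => max (-C) (min C (X00 ω)) with hY
  have hYC : ∀ ω, |Y ω| ≤ C := fun ω =>
    abs_le.2 ⟨le_max_left _ _, max_le (by linarith) (min_le_left _ _)⟩
  have hYX : ∀ᵐ ω ∂P, Y ω = X00 ω := hbd.mono fun ω h => by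
    show max (-C) (min C (X00 ω)) = X00 ω
    rw [min_eq_right (abs_le.1 h).2, max_eq_right (abs_le.1 h).1]
  have hYm : Measurable[F00] Y := by
    rw [hF0] at hX00meas
    exact measurable_const.max (measurable_const.min hX00meas)
  set x : ℕ → ℕ → Ω → ℝ := fun k j ω => Y (T k (S j ω)) with hx
  have hxm : ∀ k j : ℕ, BddMeas (F k j) (x k j) := fun k j => by
    refine ⟨?_, C, fun ω => hYC _⟩
    rw [hF]
    exact hYm.comp (comap_measurable _)
  have hxX : ∀ k j : ℕ, x k j =ᵐ[P] X k j := fun k j => by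
    rw [hX]
    exact (hTSm k j).quasiMeasurePreserving.ae hYX
  have hiter : ∀ j : ℕ, S j = (S 1)^[j] := fun j => by
    induction j with
    | zero => simpa using hS0
    | succ j ih => rw [Nat.cast_succ, hSadd, ih, Function.iterate_succ]
  have hcore := ae_tendsto_limsup_integral_condExpKernel F hmono1 hmono2 hFle hxm hC.le
    (fun k j ω => hYC _)
    (fun k j u v huv => (condExp_congr_ae (hxX k j)).trans (hortho k j u v huv)) hSerg
    (fun k j ω => by simp only [hx, Nat.cast_zero, hS0, id, hiter j]) (s := σ ^ 2) (fun k => by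
      have hYb : BddMeas m0 (fun ω => Y ω * Y ω) :=
        BddMeas.mul ⟨hYm.mono hF00 le_rfl, C, hYC⟩ ⟨hYm.mono hF00 le_rfl, C, hYC⟩
      rw [← hσ, (hTSm k (0 : ℕ)).integral_comp_bddMeas hYb]
      exact integral_congr_ae (hYX.mono fun ω h => by simp only [h, sq]))
  have hxall : ∀ᵐ ω ∂P, ∀ k j : ℕ, x k j ω = X k j ω :=
    ae_all_iff.2 fun k => ae_all_iff.2 fun j => hxX k j
  have hGint : ∀ᵐ ω ∂P, ∀ n v : ℕ, G n v ω = ∫ ω', |(∑ k ∈ Finset.range n,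
      ((∑ j ∈ Finset.range v, x k j ω') / √v) ^ 2) / n - σ ^ 2|
        ∂(condExpKernel P (⨆ n : ℤ, F n 0) ω) := by
    refine ae_all_iff.2 fun n => ae_all_iff.2 fun v => ?_
    have hxm0 : ∀ k j, BddMeas m0 (x k j) := fun k j => (hxm k j).mono (hFle _ _)
    have hb : BddMeas m0 (fun ω' => |(∑ k ∈ Finset.range n,
        ((∑ j ∈ Finset.range v, x k j ω') / √v) ^ 2) / n - σ ^ 2|) :=
      (((BddMeas.sum _ fun k _ => ((BddMeas.sum _ fun j _ => hxm0 k j).div_const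
        _).pow 2).div_const _).sub (BddMeas.const _)).abs
    rw [hG]
    refine (condExp_congr_ae ?_).trans
      (condExp_ae_eq_integral_condExpKernel (iSup_le fun n => hFle n 0) (hb.integrable P))
    filter_upwards [hxall] with ω h
    simp only [hFkv, h]
  filter_upwards [hcore, hGint] with ω h1 h2
  simpa only [h2] using h1
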